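/- For every unit quaternion q and every κ ∈ ℝ, the following two identities of subsets of ℍ hold: C(−q, κ) = C(q, κ), and { z·i : z ∈ C(q,κ) } = C(q·i, −κ). -/

import Mathlib

open Quaternion

/-- The quaternion unit `i`. -/
def qI : ℍ[ℝ] := ⟨0, 1, 0, 0⟩

/-- The quaternion unit `k`. -/
def qK : ℍ[ℝ] := ⟨0, 0, 0, 1⟩

/-- The purely imaginary unit quaternion `u(κ) = (κ·i + k)/√(1+κ²)`. -/
noncomputable def uK (κ : ℝ) : ℍ[ℝ] := (Real.sqrt (1 + κ ^ 2))⁻¹ • (κ • qI + qK)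

/-- The great circle `C(q,κ) = { q·(cos t + u(κ)·sin t) : t ∈ ℝ }`. -/
noncomputable def circC (q : ℍ[ℝ]) (κ : ℝ) : Set ℍ[ℝ] :=
  {z | ∃ t : ℝ, z = q * ((Real.cos t : ℍ[ℝ]) + Real.sin t • uK κ)}

@[simp] lemma qI_re : qI.re = 0 := rfl
@[simp] lemma qI_imI : qI.imI = 1 := rfl
@[simp] lemma qI_imJ : qI.imJ = 0 := rfl
@[simp] lemma qI_imK : qI.imK = 0 := rfl
@[simp] lemma qK_re : qK.re = 0 := rfl
@[simp] lemma qK_imI : qK.imI = 0 := rfl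
@[simp] lemma qK_imJ : qK.imJ = 0 := rfl
@[simp] lemma qK_imK : qK.imK = 1 := rfl

lemma uK_mul_qI (κ : ℝ) : uK κ * qI = -(qI * uK (-κ)) := by
  ext <;> simp [uK]

lemma cos_add_sin_smul_uK_mul_qI (κ t : ℝ) :
    ((Real.cos t : ℍ[ℝ]) + Real.sin t • uK κ) * qI =
      qI * ((Real.cos (-t) : ℍ[ℝ]) + Real.sin (-t) • uK (-κ)) := by
  rw [add_mul, mul_add, smul_mul_assoc, uK_mul_qI, mul_smul_comm, Real.cos_neg, Real.sin_neg,
    Quaternion.coe_commutes, neg_smul, smul_neg]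

lemma circC_neg_subset (q : ℍ[ℝ]) (κ : ℝ) : circC (-q) κ ⊆ circC q κ := by
  rintro z ⟨t, rfl⟩
  refine ⟨t + Real.pi, ?_⟩
  rw [Real.cos_add_pi, Real.sin_add_pi, Quaternion.coe_neg, neg_smul, ← neg_add, mul_neg, neg_mul]

/-- **Symmetries of the great circles `C(q,κ)`:**
`C(−q,κ) = C(q,κ)` and `C(q,κ)·i = C(q·i, −κ)` as subsets of `ℍ`. -/
theorem stmt9 (q : ℍ[ℝ]) (hq : ‖q‖ = 1) (κ : ℝ) :
    circC (-q) κ = circC q κ ∧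
    {w : ℍ[ℝ] | ∃ z ∈ circC q κ, w = z * qI} = circC (q * qI) (-κ) := by
  refine ⟨(circC_neg_subset q κ).antisymm ?_, ?_⟩
  · simpa using circC_neg_subset (-q) κ
  · ext w
    constructor
    · rintro ⟨_, ⟨t, rfl⟩, rfl⟩
      exact ⟨-t, by rw [mul_assoc, cos_add_sin_smul_uK_mul_qI, mul_assoc]⟩
    · rintro ⟨t, rfl⟩
      refine ⟨_, ⟨-t, rfl⟩, ?_⟩
      rw [mul_assoc, mul_assoc, cos_add_sin_smul_uK_mul_qI, neg_neg]
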